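/- Let 𝐌=(M_1,…,M_k) be a tuple of real d×d matrices which is irreducible or positively irreducible. Then 𝐌 has a uniform Lyapunov exponent modulo 0 if and only if P(𝐌,2) + P(𝐌,6) = 2·P(𝐌,4). -/

import Mathlib

open Filter Real MeasureTheory

/-- The matrix norm `‖A‖ = ∑_{i,j} |A i j|`. -/
noncomputable def mnorm {d : ℕ} (A : Matrix (Fin d) (Fin d) ℝ) : ℝ :=
  ∑ i, ∑ j, |A i j|

/-- The product `M_{j₁} ⋯ M_{jₙ}` along a word `w = j₁⋯jₙ`. -/
noncomputable def wordProd {d k : ℕ} (M : Fin k → Matrix (Fin d) (Fin d) ℝ)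
    (w : List (Fin k)) : Matrix (Fin d) (Fin d) ℝ :=
  (w.map M).prod

/-- `𝐌` has a uniform Lyapunov exponent modulo 0. -/
def HasULE {d k : ℕ} (M : Fin k → Matrix (Fin d) (Fin d) ℝ) : Prop :=
  ∃ C : ℝ, 0 < C ∧ ∃ lam : ℝ, ∀ w : List (Fin k), w ≠ [] →
    wordProd M w = 0 ∨
      (C⁻¹ * Real.exp (lam * w.length) ≤ mnorm (wordProd M w) ∧
        mnorm (wordProd M w) ≤ C * Real.exp (lam * w.length))

/-- `𝐌` is irreducible: no nonzero proper subspace is invariant under all `M i`. -/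
def MatIrred {d k : ℕ} (M : Fin k → Matrix (Fin d) (Fin d) ℝ) : Prop :=
  ∀ V : Submodule ℝ (Fin d → ℝ),
    (∀ i, ∀ v ∈ V, (M i).mulVec v ∈ V) → V = ⊥ ∨ V = ⊤

/-- `𝐌` is positively irreducible. -/
def PosIrred {d k : ℕ} (M : Fin k → Matrix (Fin d) (Fin d) ℝ) : Prop :=
  (∀ i a b, 0 ≤ M i a b) ∧
    ∃ ℓ : ℕ, 1 ≤ ℓ ∧ ∀ a b, 0 < (∑ j ∈ Finset.Icc 1 ℓ, (∑ i, M i) ^ j) a b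

/-- A single nonnegative matrix is positively irreducible:
some partial sum of its powers is entrywise positive. -/
def PosIrredMat {n : ℕ} (A : Matrix (Fin n) (Fin n) ℝ) : Prop :=
  ∃ ℓ : ℕ, 1 ≤ ℓ ∧ ∀ a b, 0 < (∑ j ∈ Finset.Icc 1 ℓ, A ^ j) a b


section Mnorm

variable {d : ℕ}

lemma mnorm_nonneg (A : Matrix (Fin d) (Fin d) ℝ) : 0 ≤ mnorm A :=
  Finset.sum_nonneg fun _ _ => Finset.sum_nonneg fun _ _ => abs_nonneg _

lemma mnorm_eq_zero_iff (A : Matrix (Fin d) (Fin d) ℝ) : mnorm A = 0 ↔ A = 0 := by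
  constructor
  · intro h
    ext i j
    rw [mnorm, Finset.sum_eq_zero_iff_of_nonneg
      (fun _ _ => Finset.sum_nonneg fun _ _ => abs_nonneg _)] at h
    have h2 := h i (Finset.mem_univ _)
    rw [Finset.sum_eq_zero_iff_of_nonneg (fun _ _ => abs_nonneg _)] at h2
    simpa using h2 j (Finset.mem_univ _)
  · rintro rfl
    simp [mnorm]

lemma mnorm_pos {A : Matrix (Fin d) (Fin d) ℝ} (h : A ≠ 0) : 0 < mnorm A :=
  lt_of_le_of_ne (mnorm_nonneg A) fun h0 => h ((mnorm_eq_zero_iff A).1 h0.symm)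

lemma mnorm_mul_le (A B : Matrix (Fin d) (Fin d) ℝ) : mnorm (A * B) ≤ mnorm A * mnorm B := by
  have hrow : ∀ l, ∑ j, |B l j| ≤ mnorm B := fun l =>
    Finset.single_le_sum (f := fun l => ∑ j, |B l j|)
      (fun _ _ => Finset.sum_nonneg fun _ _ => abs_nonneg _) (Finset.mem_univ l)
  calc mnorm (A * B) ≤ ∑ i, ∑ j, ∑ l, |A i l| * |B l j| := by
        refine Finset.sum_le_sum fun i _ => Finset.sum_le_sum fun j _ => ?_
        rw [Matrix.mul_apply]
        refine (Finset.abs_sum_le_sum_abs _ _).trans (le_of_eq ?_)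
        simp [abs_mul]
    _ = ∑ i, ∑ l, |A i l| * ∑ j, |B l j| := by
        refine Finset.sum_congr rfl fun i _ => ?_
        rw [Finset.sum_comm]
        simp [Finset.mul_sum]
    _ ≤ ∑ i, ∑ l, |A i l| * mnorm B :=
        Finset.sum_le_sum fun i _ => Finset.sum_le_sum fun l _ =>
          mul_le_mul_of_nonneg_left (hrow l) (abs_nonneg _)
    _ = mnorm A * mnorm B := by
        simp [mnorm, Finset.sum_mul]

lemma norm_mulVec_le_mnorm (A : Matrix (Fin d) (Fin d) ℝ) (v : Fin d → ℝ) :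
    ‖A.mulVec v‖ ≤ mnorm A * ‖v‖ := by
  refine (pi_norm_le_iff_of_nonneg (mul_nonneg (mnorm_nonneg A) (norm_nonneg v))).2 fun i => ?_
  calc ‖A.mulVec v i‖ ≤ ∑ j, |A i j| * ‖v‖ := by
        rw [Matrix.mulVec, dotProduct, Real.norm_eq_abs]
        refine (Finset.abs_sum_le_sum_abs _ _).trans (Finset.sum_le_sum fun j _ => ?_)
        rw [abs_mul]
        exact mul_le_mul_of_nonneg_left (norm_le_pi_norm v j) (abs_nonneg _)
    _ = (∑ j, |A i j|) * ‖v‖ := by rw [Finset.sum_mul]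
    _ ≤ mnorm A * ‖v‖ := by
        refine mul_le_mul_of_nonneg_right ?_ (norm_nonneg v)
        exact Finset.single_le_sum (f := fun l => ∑ j, |A l j|)
          (fun _ _ => Finset.sum_nonneg fun _ _ => abs_nonneg _) (Finset.mem_univ i)

lemma mnorm_le_sum_norm_mulVec_single (A : Matrix (Fin d) (Fin d) ℝ) :
    mnorm A ≤ d * ∑ j, ‖A.mulVec (Pi.single j 1)‖ := by
  calc mnorm A ≤ ∑ _i : Fin d, ∑ j, ‖A.mulVec (Pi.single j 1)‖ := by
        refine Finset.sum_le_sum fun i _ => Finset.sum_le_sum fun j _ => ?_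
        have := norm_le_pi_norm (A.mulVec (Pi.single j 1)) i
        simpa using this
    _ = d * ∑ j, ‖A.mulVec (Pi.single j 1)‖ := by simp

end Mnorm

section Words

variable {d k : ℕ} (M : Fin k → Matrix (Fin d) (Fin d) ℝ)

lemma wordProd_nil : wordProd M [] = 1 := by simp [wordProd]

lemma wordProd_cons (i : Fin k) (w : List (Fin k)) :
    wordProd M (i :: w) = M i * wordProd M w := by simp [wordProd]

lemma wordProd_append (u v : List (Fin k)) :
    wordProd M (u ++ v) = wordProd M u * wordProd M v := by simp [wordProd]

/-- The partition sum `∑ ‖M_w‖ ^ q` over all words `w` of length `n`. -/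
noncomputable def partitionSum (q n : ℕ) : ℝ :=
  ∑ f : Fin n → Fin k, mnorm (wordProd M (List.ofFn f)) ^ q

/-- The sum `∑ ‖M_w x‖ ^ q` over all words `w` of length `n`. -/
noncomputable def orbitSum (q n : ℕ) (x : Fin d → ℝ) : ℝ :=
  ∑ f : Fin n → Fin k, ‖(wordProd M (List.ofFn f)).mulVec x‖ ^ q

lemma partitionSum_nonneg (q n : ℕ) : 0 ≤ partitionSum M q n :=
  Finset.sum_nonneg fun _ _ => pow_nonneg (mnorm_nonneg _) _

lemma orbitSum_nonneg (q n : ℕ) (x : Fin d → ℝ) : 0 ≤ orbitSum M q n x :=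
  Finset.sum_nonneg fun _ _ => pow_nonneg (norm_nonneg _) _

lemma partitionSum_add_le (q m n : ℕ) :
    partitionSum M q (m + n) ≤ partitionSum M q m * partitionSum M q n := by
  unfold partitionSum
  rw [Finset.sum_mul_sum, ← Fintype.sum_prod_type', ← (Fin.appendEquiv m n).sum_comp]
  refine Finset.sum_le_sum fun p _ => ?_
  have : List.ofFn (Fin.appendEquiv m n p) = List.ofFn p.1 ++ List.ofFn p.2 :=
    List.ofFn_fin_append p.1 p.2
  rw [this, wordProd_append, ← mul_pow]
  exact pow_le_pow_left₀ (mnorm_nonneg _) (mnorm_mul_le _ _) _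

lemma orbitSum_succ (q n : ℕ) (x : Fin d → ℝ) :
    orbitSum M q (n + 1) x = ∑ i, orbitSum M q n ((M i).mulVec x) := by
  unfold orbitSum
  rw [← Fintype.sum_prod_type', ← (Fin.snocEquiv fun _ : Fin (n + 1) => Fin k).sum_comp]
  refine Finset.sum_congr rfl fun p _ => ?_
  have : List.ofFn (Fin.snocEquiv (fun _ : Fin (n + 1) => Fin k) p) = List.ofFn p.2 ++ [p.1] := by
    rw [List.ofFn_succ']
    simp [Fin.snocEquiv]
  rw [this, wordProd_append, wordProd_cons, wordProd_nil, mul_one, Matrix.mulVec_mulVec]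

lemma orbitSum_le (q n : ℕ) (x : Fin d → ℝ) :
    orbitSum M q n x ≤ partitionSum M q n * ‖x‖ ^ q := by
  unfold orbitSum partitionSum
  rw [Finset.sum_mul]
  refine Finset.sum_le_sum fun f _ => ?_
  rw [← mul_pow]
  exact pow_le_pow_left₀ (norm_nonneg _) (norm_mulVec_le_mnorm _ _) _

lemma orbitSum_smul (q n : ℕ) (t : ℝ) (ht : 0 ≤ t) (x : Fin d → ℝ) :
    orbitSum M q n (t • x) = t ^ q * orbitSum M q n x := by
  unfold orbitSum
  rw [Finset.mul_sum]
  refine Finset.sum_congr rfl fun f _ => ?_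
  rw [Matrix.mulVec_smul, norm_smul, mul_pow, Real.norm_of_nonneg ht]

lemma orbitSum_convex (q n : ℕ) (x y : Fin d → ℝ) (a b : ℝ) (ha : 0 ≤ a) (hb : 0 ≤ b)
    (hab : a + b = 1) :
    orbitSum M q n (a • x + b • y) ≤ a * orbitSum M q n x + b * orbitSum M q n y := by
  unfold orbitSum
  rw [Finset.mul_sum, Finset.mul_sum, ← Finset.sum_add_distrib]
  refine Finset.sum_le_sum fun f _ => ?_
  have h := (convexOn_norm (convex_univ : Convex ℝ (Set.univ : Set (Fin d → ℝ)))).pow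
    (fun x _ => norm_nonneg x) q
  have h2 := h.2 (Set.mem_univ ((wordProd M (List.ofFn f)).mulVec x))
    (Set.mem_univ ((wordProd M (List.ofFn f)).mulVec y)) ha hb hab
  simpa [Matrix.mulVec_add, Matrix.mulVec_smul] using h2

/-- The number `C` and the finite set `U` of words bound the norm of every product `M_w` by the
norm of `M_w M_u x` for some `u ∈ U`. -/
def OrbitNorming (x : Fin d → ℝ) (U : Finset (List (Fin k))) (C : ℝ) : Prop :=
  ∀ w, ∃ u ∈ U, mnorm (wordProd M w) ≤ C * ‖(wordProd M w).mulVec ((wordProd M u).mulVec x)‖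

variable {M}

lemma OrbitNorming.partitionSum_le {x : Fin d → ℝ} {U : Finset (List (Fin k))} {C : ℝ}
    (h : OrbitNorming M x U C) (hC : 0 ≤ C) (q n : ℕ) :
    partitionSum M q n ≤ C ^ q * ∑ u ∈ U, orbitSum M q n ((wordProd M u).mulVec x) := by
  unfold partitionSum orbitSum
  rw [Finset.sum_comm, Finset.mul_sum]
  refine Finset.sum_le_sum fun f _ => ?_
  obtain ⟨u, hu, hle⟩ := h (List.ofFn f)
  refine (pow_le_pow_left₀ (mnorm_nonneg _) hle q).trans ?_
  rw [mul_pow]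
  refine mul_le_mul_of_nonneg_left ?_ (pow_nonneg hC q)
  exact Finset.single_le_sum
    (f := fun u => ‖(wordProd M (List.ofFn f)).mulVec ((wordProd M u).mulVec x)‖ ^ q)
    (fun _ _ => pow_nonneg (norm_nonneg _) _) hu

variable (M)

lemma exp_mul_le_partitionSum (q : ℕ) (p : ℝ) (hpos : ∀ n, 0 < partitionSum M q n)
    (hlim : Tendsto (fun n : ℕ => (n : ℝ)⁻¹ * Real.log (partitionSum M q n)) atTop (nhds p))
    (n : ℕ) : Real.exp (p * n) ≤ partitionSum M q n := by
  have hsub : Subadditive fun n => Real.log (partitionSum M q n) := fun m n => by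
    rw [← Real.log_mul (hpos m).ne' (hpos n).ne']
    exact Real.log_le_log (hpos _) (partitionSum_add_le M q m n)
  have hlim' : Tendsto (fun n : ℕ => Real.log (partitionSum M q n) / n) atTop (nhds p) :=
    hlim.congr fun n => by rw [div_eq_inv_mul]
  have hbdd := hlim'.bddBelow_range
  have hp : hsub.lim = p := tendsto_nhds_unique (hsub.tendsto_lim hbdd) hlim'
  rw [← Real.le_log_iff_exp_le (hpos n)]
  have key : ∀ m : ℕ, m ≠ 0 → p * m ≤ Real.log (partitionSum M q m) := fun m hm => by
    have h := hsub.lim_le_div hbdd hm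
    rw [hp] at h
    exact (le_div_iff₀ (by positivity)).1 h
  rcases eq_or_ne n 0 with rfl | hn
  · have h0 : partitionSum M q (0 + 0) ≤ partitionSum M q 0 * partitionSum M q 0 :=
      partitionSum_add_le M q 0 0
    have h1 : 1 ≤ partitionSum M q 0 := by
      have := hpos 0
      rw [add_zero] at h0
      nlinarith
    simpa using Real.log_nonneg h1
  · exact key n hn

/-- The generating function of the partition sums, at radius `exp (-p - 1 / (N + 1))`. -/
noncomputable def partitionSeries (q : ℕ) (p : ℝ) (N : ℕ) : ℝ :=
  ∑' m : ℕ, Real.exp (-p - 1 / (N + 1)) ^ m * partitionSum M q m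

/-- The generating function of the orbit sums, at radius `exp (-p - 1 / (N + 1))`. -/
noncomputable def orbitSeries (q : ℕ) (p : ℝ) (N : ℕ) (x : Fin d → ℝ) : ℝ :=
  ∑' m : ℕ, Real.exp (-p - 1 / (N + 1)) ^ m * orbitSum M q m x

section Series

variable {q : ℕ} {p : ℝ} (hpos : ∀ n, 0 < partitionSum M q n)
    (hlim : Tendsto (fun n : ℕ => (n : ℝ)⁻¹ * Real.log (partitionSum M q n)) atTop (nhds p))

include hpos hlim

lemma summable_partitionSeries (N : ℕ) :
    Summable fun m : ℕ => Real.exp (-p - 1 / (N + 1)) ^ m * partitionSum M q m := by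
  set t : ℝ := 1 / (N + 1) with ht
  have htpos : 0 < t := by positivity
  have hr : Real.exp (-(t / 2)) < 1 := by
    rw [Real.exp_lt_one_iff]; linarith
  refine Summable.of_norm_bounded_eventually_nat
    (summable_geometric_of_lt_one (Real.exp_pos _).le hr) ?_
  have hev := hlim.eventually (gt_mem_nhds (show p < p + t / 2 by linarith))
  filter_upwards [hev, eventually_gt_atTop 0] with m hm hm0
  have hm' : (0 : ℝ) < m := by exact_mod_cast hm0
  rw [inv_mul_lt_iff₀ hm'] at hm
  have hS : partitionSum M q m ≤ Real.exp (m * (p + t / 2)) :=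
    (Real.log_le_iff_le_exp (hpos m)).1 hm.le
  rw [Real.norm_of_nonneg (mul_nonneg (by positivity) (hpos m).le)]
  calc _ ≤ Real.exp (-p - t) ^ m * Real.exp (m * (p + t / 2)) := by gcongr
    _ = Real.exp (-(t / 2)) ^ m := by
      rw [← Real.exp_nat_mul, ← Real.exp_nat_mul, ← Real.exp_add]
      ring_nf

lemma summable_orbitSeries (N : ℕ) (x : Fin d → ℝ) :
    Summable fun m : ℕ => Real.exp (-p - 1 / (N + 1)) ^ m * orbitSum M q m x := by
  refine Summable.of_nonneg_of_le (fun m => mul_nonneg (by positivity) (orbitSum_nonneg M q m x))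
    (fun m => ?_) ((summable_partitionSeries M hpos hlim N).mul_right (‖x‖ ^ q))
  rw [mul_assoc]
  exact mul_le_mul_of_nonneg_left (orbitSum_le M q m x) (by positivity)

lemma le_partitionSeries (N : ℕ) : (N : ℝ) + 1 ≤ partitionSeries M q p N := by
  set t : ℝ := 1 / (N + 1) with ht
  have htpos : 0 < t := by positivity
  have hr : Real.exp (-t) < 1 := by
    rw [Real.exp_lt_one_iff]; linarith
  have hle : ∑' m : ℕ, Real.exp (-t) ^ m ≤ partitionSeries M q p N := by
    refine Summable.tsum_le_tsum (fun m => ?_)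
      (summable_geometric_of_lt_one (Real.exp_pos _).le hr) (summable_partitionSeries M hpos hlim N)
    calc Real.exp (-t) ^ m = Real.exp (-p - t) ^ m * Real.exp (p * m) := by
          rw [← Real.exp_nat_mul, ← Real.exp_nat_mul, ← Real.exp_add]
          ring_nf
      _ ≤ _ := by
        gcongr
        exact exp_mul_le_partitionSum M q p hpos hlim m
  rw [tsum_geometric_of_lt_one (Real.exp_pos _).le hr] at hle
  refine le_trans ?_ hle
  have h1 : 1 - Real.exp (-t) ≤ t := by
    have := Real.add_one_le_exp (-t)
    linarith
  have h2 : 0 < 1 - Real.exp (-t) := by linarith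
  calc (N : ℝ) + 1 = t⁻¹ := by rw [ht]; simp
    _ ≤ _ := inv_anti₀ h2 h1

lemma orbitSeries_le (N : ℕ) (x : Fin d → ℝ) :
    orbitSeries M q p N x ≤ ‖x‖ ^ q * partitionSeries M q p N := by
  rw [partitionSeries, mul_comm, ← tsum_mul_right]
  refine Summable.tsum_le_tsum (fun m => ?_) (summable_orbitSeries M hpos hlim N x)
    ((summable_partitionSeries M hpos hlim N).mul_right _)
  rw [mul_assoc]
  exact mul_le_mul_of_nonneg_left (orbitSum_le M q m x) (by positivity)

lemma orbitSeries_eq (N : ℕ) (x : Fin d → ℝ) :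
    orbitSeries M q p N x = orbitSum M q 0 x +
      Real.exp (-p - 1 / (N + 1)) * ∑ i, orbitSeries M q p N ((M i).mulVec x) := by
  rw [orbitSeries, (summable_orbitSeries M hpos hlim N x).tsum_eq_zero_add]
  simp only [pow_zero, one_mul, orbitSeries]
  rw [← Summable.tsum_finsetSum fun i _ => summable_orbitSeries M hpos hlim N _, ← tsum_mul_left]
  congr 2
  ext m
  rw [orbitSum_succ, pow_succ', mul_assoc, Finset.mul_sum]

lemma orbitSeries_convex (N : ℕ) (x y : Fin d → ℝ) (a b : ℝ) (ha : 0 ≤ a) (hb : 0 ≤ b)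
    (hab : a + b = 1) :
    orbitSeries M q p N (a • x + b • y) ≤
      a * orbitSeries M q p N x + b * orbitSeries M q p N y := by
  have hx := (summable_orbitSeries M hpos hlim N x).mul_left a
  have hy := (summable_orbitSeries M hpos hlim N y).mul_left b
  rw [orbitSeries, orbitSeries, orbitSeries, ← tsum_mul_left, ← tsum_mul_left, ← hx.tsum_add hy]
  refine Summable.tsum_le_tsum (fun m => ?_) (summable_orbitSeries M hpos hlim N _) (hx.add hy)
  have := mul_le_mul_of_nonneg_left (orbitSum_convex M q m x y a b ha hb hab)
    (show 0 ≤ Real.exp (-p - 1 / ((N : ℝ) + 1)) ^ m by positivity)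
  linarith

omit hpos hlim in
lemma orbitSeries_smul (N : ℕ) (t : ℝ) (ht : 0 ≤ t) (x : Fin d → ℝ) :
    orbitSeries M q p N (t • x) = t ^ q * orbitSeries M q p N x := by
  rw [orbitSeries, orbitSeries, ← tsum_mul_left]
  congr 1
  ext m
  rw [orbitSum_smul M q m t ht]
  ring

lemma OrbitNorming.partitionSeries_le {x : Fin d → ℝ} {U : Finset (List (Fin k))} {C : ℝ}
    (h : OrbitNorming M x U C) (hC : 0 ≤ C) (N : ℕ) :
    partitionSeries M q p N ≤
      C ^ q * ∑ u ∈ U, orbitSeries M q p N ((wordProd M u).mulVec x) := by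
  simp only [orbitSeries]
  rw [← Summable.tsum_finsetSum fun i _ => summable_orbitSeries M hpos hlim N _, ← tsum_mul_left]
  refine Summable.tsum_le_tsum (fun m => ?_) (summable_partitionSeries M hpos hlim N)
    ((summable_sum fun i _ => summable_orbitSeries M hpos hlim N _).mul_left _)
  rw [← Finset.mul_sum, mul_left_comm]
  exact mul_le_mul_of_nonneg_left (h.partitionSum_le hC q m) (by positivity)

lemma exists_eigenfunction :
    ∃ φ : (Fin d → ℝ) → ℝ, Continuous φ ∧ (∀ x, 0 ≤ φ x) ∧
      (∀ t : ℝ, 0 ≤ t → ∀ x, φ (t • x) = t ^ q * φ x) ∧ (∀ x, φ x ≤ ‖x‖ ^ q) ∧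
      (∀ x, ∑ i, φ ((M i).mulVec x) = Real.exp p * φ x) ∧
      ∀ x U C, 0 ≤ C → OrbitNorming M x U C → 0 < φ x := by
  have hZ : ∀ N, 0 < partitionSeries M q p N := fun N =>
    lt_of_lt_of_le (by positivity) (le_partitionSeries M hpos hlim N)
  have h0 : ∀ N x, 0 ≤ orbitSeries M q p N x := fun N x =>
    tsum_nonneg fun m => mul_nonneg (by positivity) (orbitSum_nonneg M q m x)
  set g : ℕ → (Fin d → ℝ) → ℝ := fun N x => orbitSeries M q p N x / partitionSeries M q p N with hg
  have hg0 : ∀ N x, 0 ≤ g N x := fun N x => div_nonneg (h0 N x) (hZ N).le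
  have hgle : ∀ N x, g N x ≤ ‖x‖ ^ q := fun N x =>
    (div_le_iff₀ (hZ N)).2 (orbitSeries_le M hpos hlim N x)
  set F : Ultrafilter ℕ := Filter.hyperfilter ℕ with hF
  have hFtop : (F : Filter ℕ) ≤ atTop := Nat.hyperfilter_le_atTop
  have hex : ∀ x, ∃ a, Tendsto (fun N => g N x) F (nhds a) := fun x => by
    obtain ⟨a, -, ha⟩ := isCompact_iff_ultrafilter_le_nhds.1
      (isCompact_Icc (a := (0 : ℝ)) (b := ‖x‖ ^ q)) (F.map fun N => g N x)
      (by
        rw [Filter.le_principal_iff]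
        exact Filter.mem_map.2 (Filter.univ_mem' fun N => ⟨hg0 N x, hgle N x⟩))
    exact ⟨a, ha⟩
  choose φ hφ using hex
  have hφ0 : ∀ x, 0 ≤ φ x := fun x => ge_of_tendsto' (hφ x) fun N => hg0 N x
  have hinv : Tendsto (fun N : ℕ => (1 : ℝ) / (N + 1)) F (nhds 0) :=
    tendsto_one_div_add_atTop_nhds_zero_nat.mono_left hFtop
  have heq : ∀ x, ∑ i, φ ((M i).mulVec x) = Real.exp p * φ x := fun x => by
    have hZinv : Tendsto (fun N => orbitSum M q 0 x / partitionSeries M q p N) F (nhds 0) := by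
      refine Tendsto.mono_left ?_ hFtop
      refine tendsto_const_nhds.div_atTop (tendsto_atTop_mono (fun N => ?_)
        tendsto_natCast_atTop_atTop)
      have := le_partitionSeries M hpos hlim N
      linarith
    have hs : Tendsto (fun N : ℕ => Real.exp (-p - 1 / (N + 1))) F (nhds (Real.exp (-p - 0))) :=
      (Real.continuous_exp.tendsto _).comp (tendsto_const_nhds.sub hinv)
    have hsum := tendsto_finsetSum Finset.univ fun (i : Fin k) _ => hφ ((M i).mulVec x)
    have hR := hZinv.add (hs.mul hsum)
    have hL := tendsto_nhds_unique (hφ x) (hR.congr fun N => ?_)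
    · rw [hL, sub_zero, zero_add, ← mul_assoc, ← Real.exp_add]
      simp
    · simp only [hg]
      rw [orbitSeries_eq M hpos hlim N x, ← Finset.sum_div, add_div, mul_div_assoc]
  have hφle : ∀ x, φ x ≤ ‖x‖ ^ q := fun x => le_of_tendsto' (hφ x) fun N => hgle N x
  have hconv : ConvexOn ℝ Set.univ φ := by
    refine ⟨convex_univ, fun x _ y _ a b ha hb hab => ?_⟩
    refine le_of_tendsto_of_tendsto' (hφ _) (((hφ x).const_mul a).add ((hφ y).const_mul b))
      fun N => ?_
    simp only [hg]
    rw [div_le_iff₀ (hZ N), add_mul, mul_assoc, mul_assoc, div_mul_cancel₀ _ (hZ N).ne',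
      div_mul_cancel₀ _ (hZ N).ne']
    exact orbitSeries_convex M hpos hlim N x y a b ha hb hab
  refine ⟨φ, continuousOn_univ.1 (hconv.continuousOn isOpen_univ), hφ0, fun t ht x => ?_, hφle,
    heq, fun x U C hC hU => ?_⟩
  · refine tendsto_nhds_unique (hφ _) (((hφ x).const_mul (t ^ q)).congr fun N => ?_)
    simp only [hg]
    rw [orbitSeries_smul M N t ht, mul_div_assoc]
  · refine lt_of_le_of_ne (hφ0 x) fun hx => ?_
    have hzero : ∀ u : List (Fin k), φ ((wordProd M u).mulVec x) = 0 := fun u => by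
      induction u with
      | nil => simp [wordProd_nil, ← hx]
      | cons i u ih =>
        have := heq ((wordProd M u).mulVec x)
        rw [ih, mul_zero, Finset.sum_eq_zero_iff_of_nonneg fun _ _ => hφ0 _] at this
        rw [wordProd_cons, ← Matrix.mulVec_mulVec]
        exact this i (Finset.mem_univ i)
    have hsum := (tendsto_finsetSum U fun u _ => hφ ((wordProd M u).mulVec x)).const_mul (C ^ q)
    have h1 := ge_of_tendsto' hsum (b := 1) fun N => by
      simp only [hg]
      rw [← Finset.sum_div, ← mul_div_assoc, one_le_div (hZ N)]
      exact hU.partitionSeries_le M hpos hlim hC N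
    rw [Finset.sum_eq_zero fun u _ => hzero u, mul_zero] at h1
    linarith

end Series

/-- The linear span of the orbit of `x` under all products of the matrices. -/
def orbitSpan (x : Fin d → ℝ) : Submodule ℝ (Fin d → ℝ) :=
  Submodule.span ℝ (Set.range fun u : List (Fin k) => (wordProd M u).mulVec x)

lemma self_mem_orbitSpan (x : Fin d → ℝ) : x ∈ orbitSpan M x :=
  Submodule.subset_span ⟨[], by simp [wordProd_nil]⟩

lemma mulVec_mem_orbitSpan (i : Fin k) (x v : Fin d → ℝ) (hv : v ∈ orbitSpan M x) :
    (M i).mulVec v ∈ orbitSpan M x := by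
  induction hv using Submodule.span_induction with
  | mem v hv =>
    obtain ⟨u, rfl⟩ := hv
    exact Submodule.subset_span ⟨i :: u, by simp [wordProd_cons]⟩
  | zero => simp
  | add a b _ _ ha hb => rw [Matrix.mulVec_add]; exact Submodule.add_mem _ ha hb
  | smul t a _ ha => rw [Matrix.mulVec_smul]; exact Submodule.smul_mem _ t ha

variable {M}

lemma exists_orbitNorming {m : ℕ} {x : Fin d → ℝ} {z : Fin m → Fin d → ℝ}
    (hz : ∀ j, z j ∈ orbitSpan M x) {C : ℝ} (hC : 0 ≤ C)
    (h : ∀ w, mnorm (wordProd M w) ≤ C * ∑ j, ‖(wordProd M w).mulVec (z j)‖) :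
    ∃ U C', 0 ≤ C' ∧ OrbitNorming M x U C' := by
  have hz' : ∀ j, ∃ c : List (Fin k) →₀ ℝ,
      (c.sum fun u a => a • (wordProd M u).mulVec x) = z j := fun j =>
    Finsupp.mem_span_range_iff_exists_finsupp.1 (hz j)
  choose c hc using hz'
  set U : Finset (List (Fin k)) := insert [] (Finset.univ.biUnion fun j => (c j).support) with hU
  have hcU : ∀ j, ∑ u ∈ U, c j u • (wordProd M u).mulVec x = z j := fun j => by
    rw [← hc j]
    refine (Finsupp.sum_of_support_subset _ (fun u hu => ?_) (fun u a => a • (wordProd M u).mulVec x)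
      fun u _ => zero_smul ℝ _).symm
    exact Finset.mem_insert_of_mem (Finset.mem_biUnion.2 ⟨j, Finset.mem_univ j, hu⟩)
  refine ⟨U, C * ∑ j, ∑ u ∈ U, |c j u|, mul_nonneg hC <|
    Finset.sum_nonneg fun _ _ => Finset.sum_nonneg fun _ _ => abs_nonneg _, fun w => ?_⟩
  obtain ⟨u₀, hu₀, hmax⟩ := Finset.exists_max_image U
    (fun u => ‖(wordProd M w).mulVec ((wordProd M u).mulVec x)‖) ⟨[], Finset.mem_insert_self _ _⟩
  refine ⟨u₀, hu₀, (h w).trans ?_⟩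
  rw [mul_assoc]
  refine mul_le_mul_of_nonneg_left ?_ hC
  rw [Finset.sum_mul]
  refine Finset.sum_le_sum fun j _ => ?_
  rw [← hcU j, Matrix.mulVec_sum, Finset.sum_mul]
  refine (norm_sum_le _ _).trans (Finset.sum_le_sum fun u hu => ?_)
  rw [Matrix.mulVec_smul, norm_smul, Real.norm_eq_abs]
  exact mul_le_mul_of_nonneg_left (hmax u hu) (abs_nonneg _)

lemma MatIrred.exists_orbitNorming (h : MatIrred M) {x : Fin d → ℝ} (hx : x ≠ 0) :
    ∃ U C, 0 ≤ C ∧ OrbitNorming M x U C := by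
  have htop : orbitSpan M x = ⊤ := by
    refine (h _ fun i v hv => mulVec_mem_orbitSpan M i x v hv).resolve_left fun hbot => hx ?_
    have := self_mem_orbitSpan M x
    rwa [hbot, Submodule.mem_bot] at this
  exact _root_.exists_orbitNorming (z := fun j => Pi.single j 1)
    (fun j => htop ▸ Submodule.mem_top) (Nat.cast_nonneg d)
    fun w => mnorm_le_sum_norm_mulVec_single _

lemma wordProd_entry_nonneg (h : ∀ i a b, 0 ≤ M i a b) (w : List (Fin k)) (a b : Fin d) :
    0 ≤ wordProd M w a b := by
  induction w generalizing a b with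
  | nil =>
    rw [wordProd_nil, Matrix.one_apply]
    split_ifs <;> norm_num
  | cons i w ih =>
    rw [wordProd_cons, Matrix.mul_apply]
    exact Finset.sum_nonneg fun l _ => mul_nonneg (h i a l) (ih l b)

lemma PosIrred.exists_orbitNorming (h : PosIrred M) {x : Fin d → ℝ} (hx0 : 0 ≤ x) (hx : x ≠ 0) :
    ∃ U C, 0 ≤ C ∧ OrbitNorming M x U C := by
  obtain ⟨hM, ℓ, -, hℓ⟩ := h
  set B := ∑ j ∈ Finset.Icc 1 ℓ, (∑ i, M i) ^ j with hB
  obtain ⟨b, hb⟩ : ∃ b, x b ≠ 0 := Function.ne_iff.1 hx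
  have hypos : ∀ a, 0 < B.mulVec x a := fun a =>
    Finset.sum_pos' (fun l _ => mul_nonneg (hℓ a l).le (hx0 l))
      ⟨b, Finset.mem_univ b, mul_pos (hℓ a b) (lt_of_le_of_ne (hx0 b) (Ne.symm hb))⟩
  have hpow : ∀ j, ((∑ i, M i) ^ j).mulVec x ∈ orbitSpan M x := fun j => by
    induction j with
    | zero => simpa using self_mem_orbitSpan M x
    | succ j ih =>
      rw [pow_succ', ← Matrix.mulVec_mulVec, Matrix.sum_mulVec]
      exact Submodule.sum_mem _ fun i _ => mulVec_mem_orbitSpan M i x _ ih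
  have hmem : B.mulVec x ∈ orbitSpan M x := by
    rw [hB, Matrix.sum_mulVec]
    exact Submodule.sum_mem _ fun j _ => hpow j
  have : Nonempty (Fin d) := ⟨b⟩
  obtain ⟨a₀, -, ha₀⟩ := Finset.exists_min_image Finset.univ (B.mulVec x) Finset.univ_nonempty
  set ε := B.mulVec x a₀ with hε
  have hεpos : 0 < ε := hypos a₀
  refine _root_.exists_orbitNorming (m := 1) (z := fun _ => B.mulVec x) (fun _ => hmem)
    (C := ε⁻¹ * d) (by positivity) fun w => ?_
  have hA := wordProd_entry_nonneg hM w
  set A := wordProd M w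
  rw [mul_assoc, inv_mul_eq_div, le_div_iff₀ hεpos]
  calc mnorm A * ε = ∑ i, ∑ j, A i j * ε := by
        simp only [mnorm, Finset.sum_mul, abs_of_nonneg (hA _ _)]
    _ ≤ ∑ i, A.mulVec (B.mulVec x) i :=
        Finset.sum_le_sum fun i _ => Finset.sum_le_sum fun j _ =>
          mul_le_mul_of_nonneg_left (ha₀ j (Finset.mem_univ j)) (hA i j)
    _ ≤ ∑ _i : Fin d, ‖A.mulVec (B.mulVec x)‖ :=
        Finset.sum_le_sum fun i _ => (Real.le_norm_self _).trans (norm_le_pi_norm _ i)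
    _ = _ := by simp

/-- Equality case of the Cauchy–Schwarz inequality for a family dominated from below. -/
lemma eq_of_cauchySchwarz_eq {ι : Type*} [Fintype ι] {a b g : ι → ℝ} {r A B : ℝ} (hA : 0 < A)
    (hB : 0 < B) (ha : ∀ i, 0 ≤ a i) (hb : ∀ i, 0 ≤ b i) (hg : ∀ i, 0 ≤ g i)
    (hr : 0 < r) (hle : ∀ i, (r * g i) ^ 2 ≤ a i * b i)
    (hsa : ∑ i, a i = A) (hsb : ∑ i, b i = B) (hsum : (r * ∑ i, g i) ^ 2 = A * B) (i : ι) :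
    a i * B = b i * A ∧ (r * g i) ^ 2 = a i * b i := by
  set H := r * ∑ i, g i with hH
  have hH0 : 0 ≤ H := mul_nonneg hr.le (Finset.sum_nonneg fun i _ => hg i)
  have hHpos : 0 < H := lt_of_le_of_ne hH0 fun h => by
    rw [← h] at hsum
    nlinarith [mul_pos hA hB]
  set τ := H / A with hτ
  have hτpos : 0 < τ := div_pos hHpos hA
  have hτA : τ * A = H := div_mul_cancel₀ _ hA.ne'
  have hτB : B = τ * H := by
    have : A * B = A * (τ * H) := by rw [← hsum, ← hτA]; ring
    exact mul_left_cancel₀ hA.ne' this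
  have hterm : ∀ j, 0 ≤ τ ^ 2 * a j + b j - 2 * τ * (r * g j) := fun j => by
    have h1 : (2 * τ * (r * g j)) ^ 2 ≤ (τ ^ 2 * a j + b j) ^ 2 := by
      nlinarith [hle j, sq_nonneg (τ ^ 2 * a j - b j), sq_nonneg τ]
    have h2 := abs_le_of_sq_le_sq' h1 (add_nonneg (mul_nonneg (sq_nonneg τ) (ha j)) (hb j))
    linarith [h2.2]
  have hzero : ∑ j, (τ ^ 2 * a j + b j - 2 * τ * (r * g j)) = 0 := by
    rw [Finset.sum_sub_distrib, Finset.sum_add_distrib, ← Finset.mul_sum, ← Finset.mul_sum,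
      ← Finset.mul_sum, hsa, hsb, ← hH, hτB, ← hτA]
    ring
  have hi := (Finset.sum_eq_zero_iff_of_nonneg fun j _ => hterm j).1 hzero i (Finset.mem_univ i)
  have hsq : (τ ^ 2 * a i - b i) ^ 2 ≤ 0 := by
    have h3 : τ ^ 2 * a i + b i = 2 * τ * (r * g i) := by linarith
    have h4 : (τ ^ 2 * a i + b i) ^ 2 = 4 * τ ^ 2 * (r * g i) ^ 2 := by rw [h3]; ring
    nlinarith [hle i, sq_nonneg τ]
  have hb' : b i = τ ^ 2 * a i := by
    have := pow_eq_zero_iff (two_ne_zero) |>.1 (le_antisymm hsq (sq_nonneg _))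
    linarith
  refine ⟨by rw [hb', hτB, ← hτA]; ring, ?_⟩
  have h5 : τ * (r * g i) = τ * (τ * a i) := by linarith
  rw [mul_left_cancel₀ hτpos.ne' h5, hb']
  ring

/-- `φ` is a continuous function, homogeneous of degree `q`, positive on `K \ {0}`, and an
eigenfunction of the transfer operator with eigenvalue `exp p`. -/
structure IsEigenfunction (M : Fin k → Matrix (Fin d) (Fin d) ℝ) (K : Set (Fin d → ℝ)) (q : ℕ)
    (p : ℝ) (φ : (Fin d → ℝ) → ℝ) : Prop where
  continuous : Continuous φ
  nonneg : ∀ x, 0 ≤ φ x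
  homogeneous : ∀ t : ℝ, 0 ≤ t → ∀ x, φ (t • x) = t ^ q * φ x
  le_norm_pow : ∀ x, φ x ≤ ‖x‖ ^ q
  eigen : ∀ x, ∑ i, φ ((M i).mulVec x) = Real.exp p * φ x
  pos : ∀ x ∈ K, x ≠ 0 → 0 < φ x

/-- `K` is a closed nontrivial cone, invariant under the matrices. -/
structure IsInvariantCone (M : Fin k → Matrix (Fin d) (Fin d) ℝ) (K : Set (Fin d → ℝ)) :
    Prop where
  isClosed : IsClosed K
  smul_mem : ∀ t : ℝ, 0 ≤ t → ∀ x ∈ K, t • x ∈ K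
  mulVec_mem : ∀ i, ∀ x ∈ K, (M i).mulVec x ∈ K
  nontrivial : ∃ x ∈ K, x ≠ 0

section Cone

variable {K : Set (Fin d → ℝ)} (hK : IsInvariantCone M K)

include hK

lemma IsInvariantCone.isCompact_inter_sphere : IsCompact (K ∩ Metric.sphere 0 1) :=
  (isCompact_sphere 0 1).inter_left hK.isClosed

lemma IsInvariantCone.normalize_mem {x : Fin d → ℝ} (hx : x ∈ K) (hx0 : x ≠ 0) :
    ‖x‖⁻¹ • x ∈ K ∩ Metric.sphere 0 1 := by
  refine ⟨hK.smul_mem _ (by positivity) x hx, ?_⟩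
  rw [mem_sphere_zero_iff_norm, norm_smul, norm_inv, norm_norm,
    inv_mul_cancel₀ (norm_ne_zero_iff.2 hx0)]

lemma IsInvariantCone.inter_sphere_nonempty : (K ∩ Metric.sphere 0 1).Nonempty := by
  obtain ⟨x, hx, hx0⟩ := hK.nontrivial
  exact ⟨_, hK.normalize_mem hx hx0⟩

lemma IsInvariantCone.wordProd_mulVec_mem (w : List (Fin k)) {x : Fin d → ℝ} (hx : x ∈ K) :
    (wordProd M w).mulVec x ∈ K := by
  induction w with
  | nil => simpa [wordProd_nil] using hx
  | cons i w ih =>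
    rw [wordProd_cons, ← Matrix.mulVec_mulVec]
    exact hK.mulVec_mem i _ ih

omit hK in
lemma ne_zero_of_mem_sphere_zero_one {x : Fin d → ℝ} (hx : x ∈ Metric.sphere (0 : Fin d → ℝ) 1) :
    x ≠ 0 := by
  rintro rfl
  simp at hx

lemma IsEigenfunction.exists_lower_bound {q : ℕ} {p : ℝ} {φ : (Fin d → ℝ) → ℝ}
    (h : IsEigenfunction M K q p φ) : ∃ c, 0 < c ∧ ∀ x ∈ K, x ≠ 0 → c * ‖x‖ ^ q ≤ φ x := by
  obtain ⟨y, hy, hmin⟩ := hK.isCompact_inter_sphere.exists_isMinOn hK.inter_sphere_nonempty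
    h.continuous.continuousOn
  refine ⟨φ y, h.pos y hy.1 (ne_zero_of_mem_sphere_zero_one hy.2), fun x hx hx0 => ?_⟩
  have h1 : φ y ≤ φ (‖x‖⁻¹ • x) := hmin (hK.normalize_mem hx hx0)
  have hpos : 0 < ‖x‖ := norm_pos_iff.2 hx0
  rw [h.homogeneous _ (by positivity), inv_pow, inv_mul_eq_div, le_div_iff₀ (by positivity)] at h1
  exact h1

omit hK in
lemma IsEigenfunction.map_zero {q : ℕ} {p : ℝ} {φ : (Fin d → ℝ) → ℝ}
    (h : IsEigenfunction M K q p φ) (hq : q ≠ 0) : φ 0 = 0 := by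
  have := h.homogeneous 0 le_rfl 0
  rwa [zero_smul, zero_pow hq, zero_mul] at this

/-- When the eigenvalues are in geometric progression, some orbit grows uniformly. -/
lemma exists_uniform_orbit {p₂ p₄ p₆ : ℝ} (hp : p₂ + p₆ = 2 * p₄) {f g h : (Fin d → ℝ) → ℝ}
    (hf : IsEigenfunction M K 2 p₂ f) (hg : IsEigenfunction M K 4 p₄ g)
    (hh : IsEigenfunction M K 6 p₆ h) :
    ∃ x ∈ K, x ≠ 0 ∧ ∃ D lam : ℝ, 1 ≤ D ∧ ∀ w, (wordProd M w).mulVec x ≠ 0 →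
      ‖(wordProd M w).mulVec x‖ ≤ D * Real.exp (lam * w.length) ∧
      Real.exp (lam * w.length) ≤ D * ‖(wordProd M w).mulVec x‖ := by
  have hgpos : ∀ y ∈ K ∩ Metric.sphere 0 1, 0 < g y := fun y hy =>
    hg.pos y hy.1 (ne_zero_of_mem_sphere_zero_one hy.2)
  have hcont : ContinuousOn (fun y => f y * h y / g y ^ 2) (K ∩ Metric.sphere 0 1) :=
    (hf.continuous.mul hh.continuous).continuousOn.div (hg.continuous.pow 2).continuousOn
      fun y hy => (pow_pos (hgpos y hy) 2).ne'
  obtain ⟨x, hx, hmin⟩ := hK.isCompact_inter_sphere.exists_isMinOn hK.inter_sphere_nonempty hcont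
  have hx0 := ne_zero_of_mem_sphere_zero_one hx.2
  have hfx := hf.pos x hx.1 hx0
  have hgx := hg.pos x hx.1 hx0
  have hhx := hh.pos x hx.1 hx0
  obtain ⟨r, hr, hrx⟩ : ∃ r : ℝ, 0 < r ∧ r ^ 2 = f x * h x / g x ^ 2 :=
    ⟨√(f x * h x / g x ^ 2), Real.sqrt_pos.2 (by positivity), Real.sq_sqrt (by positivity)⟩
  have hmin' : ∀ y ∈ K, (r * g y) ^ 2 ≤ f y * h y := fun y hy => by
    rcases eq_or_ne y 0 with rfl | hy0
    · rw [hf.map_zero two_ne_zero, hg.map_zero four_ne_zero]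
      simp
    have hn : 0 < ‖y‖ := norm_pos_iff.2 hy0
    have h1 : f x * h x / g x ^ 2 ≤
        f (‖y‖⁻¹ • y) * h (‖y‖⁻¹ • y) / g (‖y‖⁻¹ • y) ^ 2 := hmin (hK.normalize_mem hy hy0)
    rw [← hrx, le_div_iff₀ (pow_pos (hgpos _ (hK.normalize_mem hy hy0)) 2),
      hf.homogeneous _ (by positivity), hg.homogeneous _ (by positivity),
      hh.homogeneous _ (by positivity)] at h1
    have h2 : (‖y‖⁻¹) ^ 8 * (r * g y) ^ 2 ≤ (‖y‖⁻¹) ^ 8 * (f y * h y) := by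
      calc _ = r ^ 2 * (‖y‖⁻¹ ^ 4 * g y) ^ 2 := by ring
        _ ≤ _ := h1
        _ = _ := by ring
    exact le_of_mul_le_mul_left h2 (by positivity)
  have horbit : ∀ w : List (Fin k),
      f ((wordProd M w).mulVec x) * h x * Real.exp ((p₆ - p₂) * w.length) =
        h ((wordProd M w).mulVec x) * f x ∧
      (r * g ((wordProd M w).mulVec x)) ^ 2 =
        f ((wordProd M w).mulVec x) * h ((wordProd M w).mulVec x) := fun w => by
    induction w with
    | nil =>
      simp only [wordProd_nil, Matrix.one_mulVec, List.length_nil, Nat.cast_zero, mul_zero,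
        Real.exp_zero, mul_one]
      exact ⟨mul_comm _ _, by rw [mul_pow, hrx]; field_simp⟩
    | cons i w ih =>
      rw [wordProd_cons, ← Matrix.mulVec_mulVec]
      have hyK := hK.wordProd_mulVec_mem w hx.1
      generalize (wordProd M w).mulVec x = y at ih hyK
      rcases eq_or_ne y 0 with rfl | hy0
      · simp [hf.map_zero two_ne_zero, hg.map_zero four_ne_zero,
          hh.map_zero (show (6 : ℕ) ≠ 0 by norm_num)]
      have hfy := hf.pos y hyK hy0
      have hhy := hh.pos y hyK hy0
      obtain ⟨h1, h2⟩ := eq_of_cauchySchwarz_eq (a := fun i => f ((M i).mulVec y))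
        (b := fun i => h ((M i).mulVec y)) (g := fun i => g ((M i).mulVec y))
        (mul_pos (Real.exp_pos p₂) hfy) (mul_pos (Real.exp_pos p₆) hhy)
        (fun _ => hf.nonneg _) (fun _ => hh.nonneg _) (fun _ => hg.nonneg _) hr
        (fun i => hmin' _ (hK.mulVec_mem i y hyK)) (hf.eigen y) (hh.eigen y)
        (by
          rw [hg.eigen y]
          calc (r * (Real.exp p₄ * g y)) ^ 2 = Real.exp (2 * p₄) * (r * g y) ^ 2 := by
                rw [two_mul, Real.exp_add]; ring
            _ = _ := by rw [ih.2, ← hp, Real.exp_add]; ring) i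
      refine ⟨?_, h2⟩
      have hE : Real.exp ((p₆ - p₂) * ((i :: w).length : ℕ)) =
          Real.exp p₆ / Real.exp p₂ * Real.exp ((p₆ - p₂) * w.length) := by
        rw [← Real.exp_sub, ← Real.exp_add]
        push_cast [List.length_cons]
        ring_nf
      rw [hE]
      have hpe := Real.exp_pos p₂
      have h3 : f ((M i).mulVec y) * (Real.exp p₆ * h y) * f x =
          h ((M i).mulVec y) * (Real.exp p₂ * f y) * f x := by
        rw [h1]
      refine mul_right_cancel₀ (mul_pos hpe hfy).ne' ?_
      calc _ = f ((M i).mulVec y) * Real.exp p₆ *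
            (f y * h x * Real.exp ((p₆ - p₂) * w.length)) := by field_simp
        _ = _ := by rw [ih.1]; linarith
  obtain ⟨c, hc, hfc⟩ := hf.exists_lower_bound hK
  obtain ⟨e, he, hhe⟩ := hh.exists_lower_bound hK
  set R := h x / f x with hR
  have hRpos : 0 < R := div_pos hhx hfx
  set D := 1 + R / e + 1 / (c * R) with hD
  have hD1 : 1 ≤ D := by
    have : 0 ≤ R / e + 1 / (c * R) := by positivity
    linarith
  have hD4 : D ≤ D ^ 4 := le_self_pow₀ hD1 four_ne_zero
  refine ⟨x, hx.1, hx0, D, (p₆ - p₂) / 4, hD1, fun w hw => ?_⟩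
  have hyK := hK.wordProd_mulVec_mem w hx.1
  have h1 := (horbit w).1
  generalize (wordProd M w).mulVec x = y at hw hyK h1
  have hn : 0 < ‖y‖ := norm_pos_iff.2 hw
  set E := Real.exp ((p₆ - p₂) / 4 * w.length) with hE
  have hE4 : Real.exp ((p₆ - p₂) * w.length) = E ^ 4 := by
    rw [hE, ← Real.exp_nat_mul]
    push_cast
    ring_nf
  have hEpos : 0 < E := Real.exp_pos _
  have h2 : h y = R * f y * E ^ 4 := by
    rw [hE4] at h1
    rw [hR]
    field_simp
    linarith
  have hfy := hf.le_norm_pow y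
  have hhy := hh.le_norm_pow y
  have hfy' := hfc y hyK hw
  have hhy' := hhe y hyK hw
  constructor
  · refine le_of_pow_le_pow_left₀ four_ne_zero (by positivity) ?_
    have h3 : e * ‖y‖ ^ 4 ≤ R * E ^ 4 := by
      refine le_of_mul_le_mul_right ?_ (pow_pos hn 2)
      calc e * ‖y‖ ^ 4 * ‖y‖ ^ 2 = e * ‖y‖ ^ 6 := by ring
        _ ≤ R * f y * E ^ 4 := h2 ▸ hhy'
        _ ≤ R * ‖y‖ ^ 2 * E ^ 4 := by gcongr
        _ = _ := by ring
    rw [mul_pow]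
    calc ‖y‖ ^ 4 ≤ R / e * E ^ 4 := by
          rw [div_mul_eq_mul_div, le_div_iff₀ he]; linarith
      _ ≤ D ^ 4 * E ^ 4 := by
          gcongr
          refine le_trans ?_ hD4
          have : 0 ≤ 1 / (c * R) := by positivity
          linarith
  · refine le_of_pow_le_pow_left₀ four_ne_zero (by positivity) ?_
    have h3 : c * R * E ^ 4 ≤ ‖y‖ ^ 4 := by
      refine le_of_mul_le_mul_right ?_ (pow_pos hn 2)
      calc c * R * E ^ 4 * ‖y‖ ^ 2 = R * (c * ‖y‖ ^ 2) * E ^ 4 := by ring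
        _ ≤ R * f y * E ^ 4 := by gcongr
        _ ≤ ‖y‖ ^ 6 := h2 ▸ hhy
        _ = _ := by ring
    rw [mul_pow]
    calc E ^ 4 ≤ 1 / (c * R) * ‖y‖ ^ 4 := by
          rw [div_mul_eq_mul_div, one_mul, le_div_iff₀ (by positivity)]; linarith
      _ ≤ D ^ 4 * ‖y‖ ^ 4 := by
          gcongr
          refine le_trans ?_ hD4
          have : 0 ≤ R / e := by positivity
          linarith

lemma hasULE_of_pressure_eq {p₂ p₄ p₆ : ℝ} (hp : p₂ + p₆ = 2 * p₄)
    (hKN : ∀ x ∈ K, x ≠ 0 → ∃ U C, 0 ≤ C ∧ OrbitNorming M x U C)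
    (hex : ∀ q p, q = 2 ∧ p = p₂ ∨ q = 4 ∧ p = p₄ ∨ q = 6 ∧ p = p₆ →
      (∀ n, 0 < partitionSum M q n) ∧
        Tendsto (fun n : ℕ => (n : ℝ)⁻¹ * Real.log (partitionSum M q n)) atTop (nhds p)) :
    HasULE M := by
  have hφ : ∀ q p, q = 2 ∧ p = p₂ ∨ q = 4 ∧ p = p₄ ∨ q = 6 ∧ p = p₆ →
      ∃ φ, IsEigenfunction M K q p φ := fun q p hqp => by
    obtain ⟨φ, h1, h2, h3, h4, h5, h6⟩ := exists_eigenfunction M (hex q p hqp).1 (hex q p hqp).2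
    refine ⟨φ, h1, h2, h3, h4, h5, fun x hx hx0 => ?_⟩
    obtain ⟨U, C, hC, hU⟩ := hKN x hx hx0
    exact h6 x U C hC hU
  obtain ⟨f, hf⟩ := hφ 2 p₂ (by simp)
  obtain ⟨g, hg⟩ := hφ 4 p₄ (by simp)
  obtain ⟨h, hh⟩ := hφ 6 p₆ (by simp)
  obtain ⟨x, hx, hx0, D, lam, hD, hw⟩ := exists_uniform_orbit hK hp hf hg hh
  obtain ⟨U, C, hC, hU⟩ := hKN x hx hx0
  set G := ∑ u ∈ U, Real.exp (|lam| * u.length) with hG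
  set Q := ∑ u ∈ U, ‖(wordProd M u).mulVec x‖ with hQ
  have hG0 : 0 ≤ G := Finset.sum_nonneg fun _ _ => (Real.exp_pos _).le
  have hQ0 : 0 ≤ Q := Finset.sum_nonneg fun _ _ => norm_nonneg _
  have hGu : ∀ u ∈ U, Real.exp (|lam| * u.length) ≤ G := fun u hu =>
    Finset.single_le_sum (f := fun u : List (Fin k) => Real.exp (|lam| * u.length))
      (fun _ _ => (Real.exp_pos _).le) hu
  have hQu : ∀ u ∈ U, ‖(wordProd M u).mulVec x‖ ≤ Q := fun u hu =>
    Finset.single_le_sum (f := fun u : List (Fin k) => ‖(wordProd M u).mulVec x‖)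
      (fun _ _ => norm_nonneg _) hu
  refine ⟨1 + C * (D * G) + G * (D * Q), by positivity, lam, fun w _ => ?_⟩
  rw [or_iff_not_imp_left]
  intro hw0
  have hpos := mnorm_pos hw0
  obtain ⟨u, hu, hle⟩ := hU w
  have hne : (wordProd M (w ++ u)).mulVec x ≠ 0 := fun h0 => by
    rw [wordProd_append, ← Matrix.mulVec_mulVec] at h0
    rw [h0, norm_zero, mul_zero] at hle
    linarith
  obtain ⟨hub, hlb⟩ := hw (w ++ u) hne
  rw [wordProd_append, ← Matrix.mulVec_mulVec] at hub hlb
  have hlen : Real.exp (lam * ((w ++ u).length : ℕ)) =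
      Real.exp (lam * w.length) * Real.exp (lam * u.length) := by
    rw [← Real.exp_add, List.length_append]
    push_cast
    ring_nf
  rw [hlen] at hub hlb
  have he1 : Real.exp (lam * u.length) ≤ G :=
    le_trans (Real.exp_le_exp.2 (mul_le_mul_of_nonneg_right (le_abs_self _) (Nat.cast_nonneg _)))
      (hGu u hu)
  have he2 : 1 ≤ Real.exp (lam * u.length) * G := by
    calc 1 = Real.exp (lam * u.length) * Real.exp (-lam * u.length) := by
          rw [← Real.exp_add]; simp
      _ ≤ Real.exp (lam * u.length) * G := by
          gcongr
          exact le_trans (Real.exp_le_exp.2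
            (mul_le_mul_of_nonneg_right (neg_le_abs _) (Nat.cast_nonneg _))) (hGu u hu)
  have hE : 0 < Real.exp (lam * w.length) := Real.exp_pos _
  have hnorm : ‖(wordProd M w).mulVec ((wordProd M u).mulVec x)‖ ≤ mnorm (wordProd M w) * Q :=
    (norm_mulVec_le_mnorm _ _).trans (mul_le_mul_of_nonneg_left (hQu u hu) hpos.le)
  have hGDQ : 0 ≤ G * (D * Q) := by positivity
  have hCDG : 0 ≤ C * (D * G) := by positivity
  constructor
  · rw [inv_mul_le_iff₀ (by positivity)]
    calc Real.exp (lam * w.length)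
        ≤ Real.exp (lam * w.length) * (Real.exp (lam * u.length) * G) :=
          le_mul_of_one_le_right hE.le he2
      _ = G * (Real.exp (lam * w.length) * Real.exp (lam * u.length)) := by ring
      _ ≤ G * (D * (mnorm (wordProd M w) * Q)) :=
          mul_le_mul_of_nonneg_left
            (hlb.trans (mul_le_mul_of_nonneg_left hnorm (by linarith))) hG0
      _ = G * (D * Q) * mnorm (wordProd M w) := by ring
      _ ≤ _ := by gcongr; linarith
  · calc mnorm (wordProd M w) ≤ _ := hle
      _ ≤ C * (D * (Real.exp (lam * w.length) * Real.exp (lam * u.length))) := by gcongr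
      _ ≤ C * (D * (Real.exp (lam * w.length) * G)) := by gcongr
      _ = C * (D * G) * Real.exp (lam * w.length) := by ring
      _ ≤ _ := by gcongr; linarith

end Cone

lemma wordProd_eq_zero_of_le_length {n : ℕ} (hn : ∀ f : Fin n → Fin k, wordProd M (List.ofFn f) = 0)
    (w : List (Fin k)) (hw : n ≤ w.length) : wordProd M w = 0 := by
  have h : wordProd M (w.take n) = 0 := by
    have hlen : (w.take n).length = n := List.length_take_of_le hw
    have := hn fun i => (w.take n)[i]
    rwa [show List.ofFn (fun i : Fin n => (w.take n)[i]) = w.take n from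
      List.ext_getElem (by simp [hw]) (by simp)] at this
  rw [← List.take_append_drop n w, wordProd_append, h, zero_mul]

lemma hasULE_of_forall_wordProd_eq_zero {n : ℕ}
    (hn : ∀ f : Fin n → Fin k, wordProd M (List.ofFn f) = 0) : HasULE M := by
  set T : ℝ := ∑ m ∈ Finset.range n, ∑ f : Fin m → Fin k,
    (mnorm (wordProd M (List.ofFn f)) + (mnorm (wordProd M (List.ofFn f)))⁻¹) with hT
  have hnn : ∀ A : Matrix (Fin d) (Fin d) ℝ, 0 ≤ mnorm A + (mnorm A)⁻¹ := fun A =>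
    add_nonneg (mnorm_nonneg A) (inv_nonneg.2 (mnorm_nonneg A))
  have hT0 : 0 ≤ T := Finset.sum_nonneg fun m _ => Finset.sum_nonneg fun f _ => hnn _
  refine ⟨1 + T, by positivity, 0, fun w _ => ?_⟩
  rcases le_or_gt n w.length with hw | hw
  · exact Or.inl (wordProd_eq_zero_of_le_length hn w hw)
  rw [or_iff_not_imp_left]
  intro hw0
  have hpos := mnorm_pos hw0
  have hle : mnorm (wordProd M w) + (mnorm (wordProd M w))⁻¹ ≤ T := by
    have h1 : mnorm (wordProd M w) + (mnorm (wordProd M w))⁻¹ ≤ ∑ f : Fin w.length → Fin k,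
        (mnorm (wordProd M (List.ofFn f)) + (mnorm (wordProd M (List.ofFn f)))⁻¹) := by
      have := Finset.single_le_sum (f := fun f : Fin w.length → Fin k =>
        mnorm (wordProd M (List.ofFn f)) + (mnorm (wordProd M (List.ofFn f)))⁻¹)
        (fun f _ => hnn _) (Finset.mem_univ w.get)
      simpa only [List.ofFn_get] using this
    refine h1.trans ?_
    exact Finset.single_le_sum (f := fun m => ∑ f : Fin m → Fin k,
        (mnorm (wordProd M (List.ofFn f)) + (mnorm (wordProd M (List.ofFn f)))⁻¹))
        (fun m _ => Finset.sum_nonneg fun f _ => hnn _) (Finset.mem_range.2 hw)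
  have hinv := inv_pos.2 hpos
  simp only [zero_mul, Real.exp_zero, mul_one]
  exact ⟨inv_le_of_inv_le₀ hpos (by linarith), by linarith⟩

lemma partitionSum_pos {n : ℕ} (hn : ∃ f : Fin n → Fin k, wordProd M (List.ofFn f) ≠ 0) (q : ℕ) :
    0 < partitionSum M q n := by
  obtain ⟨f, hf⟩ := hn
  exact Finset.sum_pos' (fun _ _ => pow_nonneg (mnorm_nonneg _) _)
    ⟨f, Finset.mem_univ f, pow_pos (mnorm_pos hf) q⟩

lemma HasULE.exists_abs_log_partitionSum_sub_le (h : HasULE M)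
    (hne : ∀ n, ∃ f : Fin n → Fin k, wordProd M (List.ofFn f) ≠ 0) :
    ∃ (lam B : ℝ) (a : ℕ → ℝ), ∀ q n, q ≠ 0 → n ≠ 0 →
      |Real.log (partitionSum M q n) - q * (lam * n) - a n| ≤ q * B := by
  obtain ⟨C, hC, lam, hw⟩ := h
  classical
  set W : ∀ n, Finset (Fin n → Fin k) := fun n =>
    Finset.univ.filter fun f => wordProd M (List.ofFn f) ≠ 0 with hW
  refine ⟨lam, Real.log C, fun n => Real.log (W n).card, fun q n hq hn => ?_⟩
  have hcard : (0 : ℝ) < (W n).card := by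
    obtain ⟨f, hf⟩ := hne n
    exact_mod_cast Finset.card_pos.2 ⟨f, by simp [hW, hf]⟩
  have hS : partitionSum M q n = ∑ f ∈ W n, mnorm (wordProd M (List.ofFn f)) ^ q := by
    refine (Finset.sum_filter_of_ne ?_).symm
    intro f _ hf h0
    refine hf ?_
    rw [h0, (mnorm_eq_zero_iff _).2 rfl, zero_pow hq]
  have hf : ∀ f ∈ W n, C⁻¹ * Real.exp (lam * n) ≤ mnorm (wordProd M (List.ofFn f)) ∧
      mnorm (wordProd M (List.ofFn f)) ≤ C * Real.exp (lam * n) := fun f hf => by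
    have h1 := (hw (List.ofFn f) fun h0 => hn (by simpa using h0)).resolve_left
      (Finset.mem_filter.1 hf).2
    rwa [List.length_ofFn] at h1
  have hlow : (W n).card * (C⁻¹ * Real.exp (lam * n)) ^ q ≤ partitionSum M q n := by
    rw [hS, ← nsmul_eq_mul]
    exact Finset.card_nsmul_le_sum _ _ _ fun f hfW =>
      pow_le_pow_left₀ (by positivity) (hf f hfW).1 q
  have hupp : partitionSum M q n ≤ (W n).card * (C * Real.exp (lam * n)) ^ q := by
    rw [hS, ← nsmul_eq_mul]
    exact Finset.sum_le_card_nsmul _ _ _ fun f hfW =>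
      pow_le_pow_left₀ (mnorm_nonneg _) (hf f hfW).2 q
  have hpos := partitionSum_pos (hne n) q
  have h1 := Real.log_le_log (by positivity) hlow
  have h2 := Real.log_le_log hpos hupp
  rw [Real.log_mul hcard.ne' (by positivity), Real.log_pow,
    Real.log_mul (by positivity) (by positivity), Real.log_exp] at h1 h2
  rw [Real.log_inv] at h1
  rw [abs_le]
  constructor <;> nlinarith

lemma HasULE.pressure_eq (h : HasULE M)
    (hne : ∀ n, ∃ f : Fin n → Fin k, wordProd M (List.ofFn f) ≠ 0) {p₂ p₄ p₆ : ℝ}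
    (h₂ : Tendsto (fun n : ℕ => (n : ℝ)⁻¹ * Real.log (partitionSum M 2 n)) atTop (nhds p₂))
    (h₄ : Tendsto (fun n : ℕ => (n : ℝ)⁻¹ * Real.log (partitionSum M 4 n)) atTop (nhds p₄))
    (h₆ : Tendsto (fun n : ℕ => (n : ℝ)⁻¹ * Real.log (partitionSum M 6 n)) atTop (nhds p₆)) :
    p₂ + p₆ = 2 * p₄ := by
  obtain ⟨lam, B, a, hB⟩ := h.exists_abs_log_partitionSum_sub_le hne
  have hlim := (h₂.add h₆).sub (h₄.const_mul 2)
  have hzero := squeeze_zero_norm' (a := fun n : ℕ => (n : ℝ)⁻¹ * (16 * B)) (t₀ := atTop)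
    (f := fun n : ℕ => (n : ℝ)⁻¹ * Real.log (partitionSum M 2 n) +
      (n : ℝ)⁻¹ * Real.log (partitionSum M 6 n) -
      2 * ((n : ℝ)⁻¹ * Real.log (partitionSum M 4 n))) (by
    filter_upwards [eventually_ne_atTop 0] with n hn
    have e₂ := abs_le.1 (hB 2 n two_ne_zero hn)
    have e₄ := abs_le.1 (hB 4 n four_ne_zero hn)
    have e₆ := abs_le.1 (hB 6 n (by norm_num) hn)
    push_cast at e₂ e₄ e₆
    have : (n : ℝ)⁻¹ * Real.log (partitionSum M 2 n) +
        (n : ℝ)⁻¹ * Real.log (partitionSum M 6 n) -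
        2 * ((n : ℝ)⁻¹ * Real.log (partitionSum M 4 n)) =
        (n : ℝ)⁻¹ * (Real.log (partitionSum M 2 n) + Real.log (partitionSum M 6 n) -
          2 * Real.log (partitionSum M 4 n)) := by ring
    rw [this, norm_mul, Real.norm_of_nonneg (by positivity)]
    refine mul_le_mul_of_nonneg_left ?_ (by positivity)
    rw [Real.norm_eq_abs, abs_le]
    constructor <;> linarith [e₂.1, e₂.2, e₄.1, e₄.2, e₆.1, e₆.2])
    (by simpa using (tendsto_inv_atTop_nhds_zero_nat (𝕜 := ℝ)).mul_const (16 * B))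
  linarith [tendsto_nhds_unique hlim hzero]

lemma pressure_eq_zero_of_forall_wordProd_eq_zero {n : ℕ}
    (hn : ∀ f : Fin n → Fin k, wordProd M (List.ofFn f) = 0) {q : ℕ} (hq : q ≠ 0) {p : ℝ}
    (h : Tendsto (fun n : ℕ => (n : ℝ)⁻¹ * Real.log (partitionSum M q n)) atTop (nhds p)) :
    p = 0 := by
  refine tendsto_nhds_unique h (tendsto_const_nhds.congr' ?_)
  filter_upwards [eventually_ge_atTop n] with m hm
  have : partitionSum M q m = 0 := Finset.sum_eq_zero fun f _ => by
    rw [wordProd_eq_zero_of_le_length hn _ (by simpa using hm), (mnorm_eq_zero_iff _).2 rfl,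
      zero_pow hq]
  rw [this, Real.log_zero, mul_zero]

lemma MatIrred.isInvariantCone_univ [NeZero d] : IsInvariantCone M Set.univ where
  isClosed := isClosed_univ
  smul_mem _ _ _ _ := trivial
  mulVec_mem _ _ _ := trivial
  nontrivial := ⟨1, trivial, one_ne_zero⟩

lemma PosIrred.isInvariantCone_Ici [NeZero d] (h : PosIrred M) :
    IsInvariantCone M (Set.Ici 0) where
  isClosed := isClosed_Ici
  smul_mem _ ht _ hx := Set.mem_Ici.2 (smul_nonneg ht (Set.mem_Ici.1 hx))
  mulVec_mem i x hx := Set.mem_Ici.2 fun a =>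
    show 0 ≤ ∑ b, M i a b * x b from
      Finset.sum_nonneg fun b _ => mul_nonneg (h.1 i a b) (Set.mem_Ici.1 hx b)
  nontrivial := ⟨1, Set.mem_Ici.2 zero_le_one, one_ne_zero⟩

end Words

theorem stmt0 {d k : ℕ} [NeZero d] [NeZero k]
    (M : Fin k → Matrix (Fin d) (Fin d) ℝ)
    (hirr : MatIrred M ∨ PosIrred M)
    (P : ℝ → ℝ)
    (hP : ∀ q : ℝ, 0 < q →
      Tendsto (fun n : ℕ =>
          (n : ℝ)⁻¹ * Real.log (∑ f : Fin n → Fin k, mnorm (wordProd M (List.ofFn f)) ^ q))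
        atTop (nhds (P q))) :
    HasULE M ↔ P 2 + P 6 = 2 * P 4 := by
  have hP' : ∀ q : ℕ, q ≠ 0 →
      Tendsto (fun n : ℕ => (n : ℝ)⁻¹ * Real.log (partitionSum M q n)) atTop
        (nhds (P (q : ℝ))) := fun q hq => by
    have := hP q (by positivity)
    simpa only [partitionSum, Real.rpow_natCast] using this
  have h₂ := hP' 2 two_ne_zero
  have h₄ := hP' 4 four_ne_zero
  have h₆ := hP' 6 (by norm_num)
  push_cast at h₂ h₄ h₆
  by_cases hne : ∀ n, ∃ f : Fin n → Fin k, wordProd M (List.ofFn f) ≠ 0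
  · refine ⟨fun h => h.pressure_eq hne h₂ h₄ h₆, fun hp => ?_⟩
    have hex : ∀ q p, q = 2 ∧ p = P 2 ∨ q = 4 ∧ p = P 4 ∨ q = 6 ∧ p = P 6 →
        (∀ n, 0 < partitionSum M q n) ∧
          Tendsto (fun n : ℕ => (n : ℝ)⁻¹ * Real.log (partitionSum M q n)) atTop (nhds p) := by
      rintro q p (⟨rfl, rfl⟩ | ⟨rfl, rfl⟩ | ⟨rfl, rfl⟩)
      exacts [⟨fun n => partitionSum_pos (hne n) _, h₂⟩,
        ⟨fun n => partitionSum_pos (hne n) _, h₄⟩, ⟨fun n => partitionSum_pos (hne n) _, h₆⟩]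
    rcases hirr with h | h
    · exact hasULE_of_pressure_eq MatIrred.isInvariantCone_univ hp
        (fun x _ hx0 => h.exists_orbitNorming hx0) hex
    · exact hasULE_of_pressure_eq h.isInvariantCone_Ici hp
        (fun x hx hx0 => h.exists_orbitNorming hx hx0) hex
  · push Not at hne
    obtain ⟨n, hn⟩ := hne
    refine iff_of_true (hasULE_of_forall_wordProd_eq_zero hn) ?_
    rw [pressure_eq_zero_of_forall_wordProd_eq_zero hn two_ne_zero h₂,
      pressure_eq_zero_of_forall_wordProd_eq_zero hn four_ne_zero h₄,
      pressure_eq_zero_of_forall_wordProd_eq_zero hn (by norm_num) h₆]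
    norm_num
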